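/- Let L be a quasi-normal modal logic contained in a quasi-normal modal logic L' that has both the poly-size model property and the exponential growth property. Then there are a polynomial p, modal formulas φ_n and signatures σ_n ⊆ sig(φ_n) with |φ_n| ≤ p(n) for all n, such that for every sufficiently large n the strongest L(σ_n)-implicate of φ_n exists and every strongest L(σ_n)-implicate of φ_n has dag-size at least 2^n. -/

import Mathlib

inductive MForm (α : Type) : Type
  | top : MForm α
  | atom : α → MForm α
  | neg : MForm α → MForm α
  | and : MForm α → MForm α → MForm α
  | box : MForm α → MForm α
deriving DecidableEq

namespace MForm

def imp {α : Type} (φ ψ : MForm α) : MForm α := neg (and φ (neg ψ))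

def dia {α : Type} (φ : MForm α) : MForm α := neg (box (neg φ))

def sig {α : Type} [DecidableEq α] : MForm α → Finset α
  | top => ∅
  | atom p => {p}
  | neg φ => sig φ
  | and φ ψ => sig φ ∪ sig ψ
  | box φ => sig φ

def IsProp {α : Type} : MForm α → Prop
  | top => True
  | atom _ => True
  | neg φ => IsProp φ
  | and φ ψ => IsProp φ ∧ IsProp ψ
  | box _ => False

def subf {α : Type} [DecidableEq α] : MForm α → Finset (MForm α)
  | top => {top}
  | atom p => {atom p}
  | neg φ => insert (neg φ) (subf φ)
  | and φ ψ => insert (and φ ψ) (subf φ ∪ subf ψ)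
  | box φ => insert (box φ) (subf φ)

/-- The dag-size of a formula: the number of its distinct subformulas. -/
def dagSize {α : Type} [DecidableEq α] (φ : MForm α) : ℕ := (subf φ).card

end MForm

def psat {α : Type} (v : α → Prop) : MForm α → Prop
  | .top => True
  | .atom p => v p
  | .neg φ => ¬ psat v φ
  | .and φ ψ => psat v φ ∧ psat v ψ
  | .box _ => True

/-- Propositional tautology. -/
def PTaut {α : Type} (φ : MForm α) : Prop := ∀ v : α → Prop, psat v φ

def bigAnd {α : Type} : List (MForm α) → MForm α
  | [] => .top
  | φ :: l => .and φ (bigAnd l)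

def bigOr {α : Type} (l : List (MForm α)) : MForm α := .neg (bigAnd (l.map .neg))

def boxIter {α : Type} : ℕ → MForm α → MForm α
  | 0, φ => φ
  | n + 1, φ => .box (boxIter n φ)

def diaIter {α : Type} : ℕ → MForm α → MForm α
  | 0, φ => φ
  | n + 1, φ => MForm.dia (diaIter n φ)

/-- `□^{≤n} φ`. -/
def ble {α : Type} (n : ℕ) (φ : MForm α) : MForm α :=
  bigAnd ((List.range (n + 1)).map (fun k => boxIter k φ))

/-- `◇^{≤n} φ`. -/
def dle {α : Type} (n : ℕ) (φ : MForm α) : MForm α := .neg (ble n (.neg φ))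

def substAtoms {α β : Type} (s : α → MForm β) : MForm α → MForm β
  | .top => .top
  | .atom a => s a
  | .neg φ => .neg (substAtoms s φ)
  | .and φ ψ => .and (substAtoms s φ) (substAtoms s ψ)
  | .box φ => .box (substAtoms s φ)

structure Frame where
  W : Type
  ne : Nonempty W
  R : W → W → Prop

structure PFrame extends Frame where
  pt : W

def sat (F : Frame) (V : F.W → ℕ → Prop) : F.W → MForm ℕ → Prop
  | w, .top => True
  | w, .atom p => V w p
  | w, .neg φ => ¬ sat F V w φ
  | w, .and φ ψ => sat F V w φ ∧ sat F V w ψ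
  | w, .box φ => ∀ v, F.R w v → sat F V v φ

def validAt (F : Frame) (w : F.W) (φ : MForm ℕ) : Prop := ∀ V, sat F V w φ

def Log (𝓕 : Set PFrame) : Set (MForm ℕ) := {φ | ∀ P ∈ 𝓕, validAt P.toFrame P.pt φ}

def Rooted (F : Frame) (w : F.W) : Prop := ∀ v, Relation.ReflTransGen F.R w v

def StrImp (L : Set (MForm ℕ)) (σ : Finset ℕ) (φ χ : MForm ℕ) : Prop :=
  χ.sig ⊆ σ ∧ φ.imp χ ∈ L ∧
    ∀ ψ : MForm ℕ, ψ.sig ⊆ σ → φ.imp ψ ∈ L → χ.imp ψ ∈ L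

def UnifInt (L : Set (MForm ℕ)) (σ : Finset ℕ) (φ χ : MForm ℕ) : Prop :=
  χ.sig ⊆ σ ∧ φ.imp χ ∈ L ∧
    ∀ ψ : MForm ℕ, ψ.sig ∩ φ.sig ⊆ σ → φ.imp ψ ∈ L → χ.imp ψ ∈ L

def CraigInt (L : Set (MForm ℕ)) (φ ψ χ : MForm ℕ) : Prop :=
  φ.imp χ ∈ L ∧ χ.imp ψ ∈ L ∧ χ.sig ⊆ φ.sig ∩ ψ.sig

def HasCIP (L : Set (MForm ℕ)) : Prop :=
  ∀ φ ψ : MForm ℕ, φ.imp ψ ∈ L → ∃ χ, CraigInt L φ ψ χ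

def IsBisim (σ : Finset ℕ) (F₁ : Frame) (V₁ : F₁.W → ℕ → Prop)
    (F₂ : Frame) (V₂ : F₂.W → ℕ → Prop) (Z : F₁.W → F₂.W → Prop) : Prop :=
  (∀ w₁ w₂, Z w₁ w₂ → ∀ p ∈ σ, (V₁ w₁ p ↔ V₂ w₂ p)) ∧
  (∀ w₁ w₂ v₁, Z w₁ w₂ → F₁.R w₁ v₁ → ∃ v₂, F₂.R w₂ v₂ ∧ Z v₁ v₂) ∧
  (∀ w₁ w₂ v₂, Z w₁ w₂ → F₂.R w₂ v₂ → ∃ v₁, F₁.R w₁ v₁ ∧ Z v₁ v₂)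

def Bisim (σ : Finset ℕ) (F₁ : Frame) (V₁ : F₁.W → ℕ → Prop) (w₁ : F₁.W)
    (F₂ : Frame) (V₂ : F₂.W → ℕ → Prop) (w₂ : F₂.W) : Prop :=
  ∃ Z, IsBisim σ F₁ V₁ F₂ V₂ Z ∧ Z w₁ w₂

def IsEME (σ : Finset ℕ) (Φ : Finset (MForm ℕ)) : Prop :=
  (∀ φ ∈ Φ, φ.IsProp ∧ φ.sig ⊆ σ) ∧
  (∀ v : ℕ → Prop, ∃ φ ∈ Φ, psat v φ) ∧
  (∀ φ ∈ Φ, ∀ ψ ∈ Φ, φ ≠ ψ → ∀ v : ℕ → Prop, ¬ (psat v φ ∧ psat v ψ))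

def IsCover (σ : Finset ℕ) (Φ : Finset (MForm ℕ)) (F : Frame) (V : F.W → ℕ → Prop) : Prop :=
  ∀ φ ∈ Φ, ∀ w₁ w₂, sat F V w₁ φ → sat F V w₂ φ →
    ∀ χ : MForm ℕ, χ.IsProp → χ.sig ⊆ σ → (sat F V w₁ χ ↔ sat F V w₂ χ)

noncomputable def coverFml (σ : Finset ℕ) (Φ : Finset (MForm ℕ)) (N : ℕ) : MForm ℕ :=
  bigAnd (Φ.toList.map (fun φ => bigAnd (σ.toList.map (fun p =>
    MForm.imp (dle N (.and φ (.atom p))) (ble N (MForm.imp φ (.atom p)))))))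

/-- `withinSteps R k a b`: `b` is reachable from `a` by an `R`-path of length at most `k`. -/
def withinSteps {W : Type} (R : W → W → Prop) : ℕ → W → W → Prop
  | 0, a, b => a = b
  | k + 1, a, b => withinSteps R k a b ∨ ∃ c, withinSteps R k a c ∧ R c b

/-- A rooted pointed frame validates the logic `L`. -/
def Validates (F : Frame) (w : F.W) (L : Set (MForm ℕ)) : Prop :=
  ∀ χ ∈ L, validAt F w χ

/-- The poly-size model property. -/
def PSMP (L : Set (MForm ℕ)) : Prop :=
  ∃ r : Polynomial ℕ, ∀ φ : MForm ℕ, φ ∉ L →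
    ∃ (F : Frame) (w : F.W), Rooted F w ∧ Validates F w L ∧
      Finite F.W ∧ Nat.card F.W ≤ r.eval φ.dagSize ∧
      ∃ V : F.W → ℕ → Prop, ¬ sat F V w φ

/-- The exponential growth property. -/
def EGP (L : Set (MForm ℕ)) : Prop :=
  ∃ f : Polynomial ℕ, ∀ n : ℕ, 0 < n →
    ∃ (F : Frame) (w : F.W), Rooted F w ∧ Validates F w L ∧
      ∃ S : Set F.W, 2 ^ n ≤ S.ncard ∧ ∀ v ∈ S, withinSteps F.R (f.eval n) w v

/-! Helper material: bounded boxes, the formulas `phiF` and their strongest implicates `chiF`. -/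

def bb : ℕ → MForm ℕ → MForm ℕ
  | 0, φ => φ
  | k + 1, φ => bb k (.and φ (.box φ))

def orF (a b : MForm ℕ) : MForm ℕ := .neg (.and (.neg a) (.neg b))

def eqF (i : ℕ) : MForm ℕ :=
  orF (.and (.atom (2*i)) (.atom (2*i+1))) (.and (.neg (.atom (2*i))) (.neg (.atom (2*i+1))))

def constF (N i : ℕ) : MForm ℕ := orF (bb N (.atom (2*i+1))) (bb N (.neg (.atom (2*i+1))))

def phiF (m N : ℕ) : MForm ℕ :=
  .and (bigAnd ((List.range m).map (constF N)))
    (bb N (.neg (bigAnd ((List.range m).map eqF))))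

def litF (T : Finset ℕ) (i : ℕ) : MForm ℕ :=
  if i ∈ T then .atom (2*i) else .neg (.atom (2*i))

noncomputable def chiF (m N : ℕ) : MForm ℕ :=
  bigOr ((Finset.range m).powerset.toList.map
    (fun T => bb N (.neg (bigAnd ((List.range m).map (litF T))))))

def sigF (m : ℕ) : Finset ℕ := (Finset.range m).image (fun i => 2*i)

/-- Some type over `sigF m` is not realised within `N` steps. -/
def QQ (m N : ℕ) (F : Frame) (V : F.W → ℕ → Prop) (w : F.W) : Prop :=
  ∃ T ∈ (Finset.range m).powerset, ∀ v, withinSteps F.R N w v →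
    ¬ ∀ i < m, (V v (2*i) ↔ i ∈ T)

theorem sat_bb (F : Frame) (V : F.W → ℕ → Prop) (k : ℕ) : ∀ (φ : MForm ℕ) (w : F.W),
    sat F V w (bb k φ) ↔ ∀ v, withinSteps F.R k w v → sat F V v φ := by
  induction k with
  | zero => intro φ w; simp [bb, withinSteps]
  | succ k ih =>
    intro φ w
    simp only [bb, ih, sat, withinSteps]
    constructor
    · rintro h v (hv | ⟨c, hc, hR⟩)
      · exact (h v hv).1
      · exact (h c hc).2 v hR
    · intro h v hv
      exact ⟨h v (Or.inl hv), fun u hu => h u (Or.inr ⟨v, hv, hu⟩)⟩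

theorem sat_bigAnd (F : Frame) (V : F.W → ℕ → Prop) (w : F.W) (l : List (MForm ℕ)) :
    sat F V w (bigAnd l) ↔ ∀ φ ∈ l, sat F V w φ := by
  induction l with
  | nil => simp [bigAnd, sat]
  | cons a l ih => simp [bigAnd, sat, ih]

theorem sat_imp (F : Frame) (V : F.W → ℕ → Prop) (w : F.W) (a b : MForm ℕ) :
    sat F V w (a.imp b) ↔ (sat F V w a → sat F V w b) := by
  simp [MForm.imp, sat]

theorem sat_orF (F : Frame) (V : F.W → ℕ → Prop) (w : F.W) (a b : MForm ℕ) :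
    sat F V w (orF a b) ↔ (sat F V w a ∨ sat F V w b) := by
  simp only [orF, sat]; tauto

theorem sat_eqF (F : Frame) (V : F.W → ℕ → Prop) (w : F.W) (i : ℕ) :
    sat F V w (eqF i) ↔ (V w (2*i) ↔ V w (2*i+1)) := by
  simp only [eqF, sat_orF, sat]; tauto

theorem sat_litF (F : Frame) (V : F.W → ℕ → Prop) (w : F.W) (T : Finset ℕ) (i : ℕ) :
    sat F V w (litF T i) ↔ (V w (2*i) ↔ i ∈ T) := by
  unfold litF; split_ifs with h <;> simp [sat, h]

theorem sat_chiF (m N : ℕ) (F : Frame) (V : F.W → ℕ → Prop) (w : F.W) :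
    sat F V w (chiF m N) ↔ QQ m N F V w := by
  simp only [chiF, bigOr, QQ]
  simp only [sat, sat_bigAnd]
  simp [sat, sat_bb, sat_bigAnd, sat_litF]

theorem sat_congr (F : Frame) (V V' : F.W → ℕ → Prop) (φ : MForm ℕ) :
    (∀ w, ∀ p ∈ φ.sig, (V w p ↔ V' w p)) → ∀ w, sat F V w φ ↔ sat F V' w φ := by
  induction φ with
  | top => intros; simp [sat]
  | atom p => intro h w; simpa [sat, MForm.sig] using h w p (by simp [MForm.sig])
  | neg φ ih => intro h w; simp only [sat]; exact not_congr (ih h w)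
  | and φ ψ ih1 ih2 =>
    intro h w
    simp only [sat]
    exact and_congr (ih1 (fun w p hp => h w p (by simp [MForm.sig, hp])) w)
      (ih2 (fun w p hp => h w p (by simp [MForm.sig, hp])) w)
  | box φ ih =>
    intro h w; simp only [sat]
    exact forall_congr' fun v => imp_congr_right fun _ => ih h v

theorem withinSteps_self {W : Type} (R : W → W → Prop) (k : ℕ) (w : W) :
    withinSteps R k w w := by
  induction k with
  | zero => simp [withinSteps]
  | succ k ih => exact Or.inl ih

theorem phi_QQ (m N : ℕ) (F : Frame) (V : F.W → ℕ → Prop) (w : F.W)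
    (h : sat F V w (phiF m N)) : QQ m N F V w := by
  classical
  simp only [phiF, sat, sat_bb, sat_bigAnd] at h
  obtain ⟨h1, h2⟩ := h
  refine ⟨(Finset.range m).filter (fun i => V w (2*i+1)), by simp, fun v hv hall => h2 v hv ?_⟩
  intro φ hφ
  simp only [List.mem_map, List.mem_range] at hφ
  obtain ⟨i, hi, rfl⟩ := hφ
  rw [sat_eqF, hall i hi]
  have h3 := h1 (constF N i) (by simp only [List.mem_map, List.mem_range]; exact ⟨i, hi, rfl⟩)
  simp only [constF, sat_orF, sat_bb, sat] at h3
  have h4 := withinSteps_self F.R N w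
  simp only [Finset.mem_filter, Finset.mem_range, hi, true_and]
  rcases h3 with h3 | h3
  · have a := h3 v hv
    have b := h3 w h4
    tauto
  · have a := h3 v hv
    have b := h3 w h4
    tauto

theorem QQ_phi (m N : ℕ) (F : Frame) (V : F.W → ℕ → Prop) (w : F.W)
    (h : QQ m N F V w) : ∃ V' : F.W → ℕ → Prop,
      (∀ v i, V' v (2*i) ↔ V v (2*i)) ∧ sat F V' w (phiF m N) := by
  obtain ⟨T, _, hT⟩ := h
  refine ⟨fun v j => if j % 2 = 0 then V v j else j / 2 ∈ T, by simp, ?_⟩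
  have e : ∀ i, (2*i+1)/2 = i := by intro i; omega
  have e2 : ∀ i, (2*i+1)%2 = 1 := by intro i; omega
  simp only [phiF, sat, sat_bb, sat_bigAnd]
  constructor
  · intro φ hφ
    simp only [List.mem_map, List.mem_range] at hφ
    obtain ⟨i, hi, rfl⟩ := hφ
    simp only [constF, sat_orF, sat_bb, sat]
    by_cases hiT : i ∈ T
    · left; intro v _; simp [e, e2, hiT]
    · right; intro v _; simp [e, e2, hiT]
  · intro v hv hall
    apply hT v hv
    intro i hi
    have := hall (eqF i) (by simp only [List.mem_map, List.mem_range]; exact ⟨i, hi, rfl⟩)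
    rw [sat_eqF] at this
    simpa [e, e2] using this

theorem sig_bb (k : ℕ) : ∀ φ, (bb k φ).sig = φ.sig := by
  induction k with
  | zero => intro φ; rfl
  | succ k ih => intro φ; simp [bb, ih, MForm.sig]

theorem sig_bigAnd (l : List (MForm ℕ)) (p : ℕ) :
    p ∈ (bigAnd l).sig ↔ ∃ φ ∈ l, p ∈ φ.sig := by
  induction l with
  | nil => simp [bigAnd, MForm.sig]
  | cons a l ih => simp [bigAnd, MForm.sig, ih]

theorem sig_chiF (m N : ℕ) : (chiF m N).sig ⊆ sigF m := by
  intro p hp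
  simp only [chiF, bigOr, MForm.sig, sig_bigAnd, List.mem_map] at hp
  obtain ⟨φ, ⟨ψ, ⟨T, _, rfl⟩, rfl⟩, hp⟩ := hp
  simp only [MForm.sig, sig_bb, sig_bigAnd, List.mem_map, List.mem_range] at hp
  obtain ⟨φ, ⟨i, hi, rfl⟩, hp⟩ := hp
  have : p = 2*i := by
    unfold litF at hp; split_ifs at hp <;> simpa [MForm.sig] using hp
  simp only [sigF, Finset.mem_image, Finset.mem_range]
  exact ⟨i, hi, this.symm⟩

theorem sig_phiF (m N : ℕ) : sigF m ⊆ (phiF m N).sig := by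
  intro p hp
  simp only [sigF, Finset.mem_image, Finset.mem_range] at hp
  obtain ⟨i, hi, rfl⟩ := hp
  simp only [phiF, MForm.sig, Finset.mem_union]
  right
  simp only [MForm.sig, sig_bb, sig_bigAnd, List.mem_map, List.mem_range]
  exact ⟨_, ⟨i, hi, rfl⟩, by simp [eqF, orF, MForm.sig]⟩

theorem chi_strImp (𝓕 : Set PFrame) (m N : ℕ) :
    StrImp (Log 𝓕) (sigF m) (phiF m N) (chiF m N) := by
  refine ⟨sig_chiF m N, ?_, ?_⟩
  · intro P _ V
    rw [sat_imp, sat_chiF]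
    exact phi_QQ m N _ _ _
  · intro ψ hψ h P hP V
    rw [sat_imp, sat_chiF]
    intro hQ
    obtain ⟨V', hV', hs⟩ := QQ_phi m N _ _ _ hQ
    have h1 := h P hP V'
    rw [sat_imp] at h1
    refine (sat_congr _ V' V ψ ?_ _).1 (h1 hs)
    intro w p hp
    have := hψ hp
    simp only [sigF, Finset.mem_image, Finset.mem_range] at this
    obtain ⟨i, _, rfl⟩ := this
    exact hV' w i

theorem card_of_not_QQ (m N : ℕ) (F : Frame) [Finite F.W] (V : F.W → ℕ → Prop) (w : F.W)
    (h : ¬ QQ m N F V w) : 2 ^ m ≤ Nat.card F.W := by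
  unfold QQ at h
  push Not at h
  choose g hg1 hg2 using h
  have : Function.Injective
      (fun T : {T // T ∈ (Finset.range m).powerset} => g T.1 T.2) := by
    rintro ⟨T, hT⟩ ⟨T', hT'⟩ he
    simp only at he
    have a := hg2 T hT
    have b := hg2 T' hT'
    rw [he] at a
    rw [Finset.mem_powerset] at hT hT'
    apply Subtype.ext
    ext i
    constructor
    · intro hi
      have hm := Finset.mem_range.1 (hT hi)
      exact (b i hm).1 ((a i hm).2 hi)
    · intro hi
      have hm := Finset.mem_range.1 (hT' hi)
      exact (a i hm).1 ((b i hm).2 hi)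
  have h2 := Nat.card_le_card_of_injective _ this
  rw [Nat.card_eq_fintype_card, Fintype.card_coe, Finset.card_powerset, Finset.card_range] at h2
  exact h2

theorem exists_not_QQ (m N : ℕ) (F : Frame) (w : F.W) (S : Set F.W) (hS : 2 ^ m ≤ S.ncard)
    (hr : ∀ v ∈ S, withinSteps F.R N w v) : ∃ V : F.W → ℕ → Prop, ¬ QQ m N F V w := by
  have hfin : S.Finite := Set.finite_of_ncard_pos (lt_of_lt_of_le (by positivity) hS)
  have := hfin.fintype
  have hc : Fintype.card {T // T ∈ (Finset.range m).powerset} ≤ Fintype.card S := by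
    rw [← Nat.card_eq_fintype_card (α := S)]
    simpa [Set.ncard] using hS
  obtain ⟨e⟩ := Function.Embedding.nonempty_of_card_le hc
  refine ⟨fun v j => ∃ T, (e T : F.W) = v ∧ j / 2 ∈ T.1, ?_⟩
  rintro ⟨T, hT, h⟩
  apply h (e ⟨T, hT⟩) (hr _ (e ⟨T, hT⟩).2)
  intro i _
  have e1 : 2 * i / 2 = i := by omega
  simp only [e1]
  constructor
  · rintro ⟨T', h1, h2⟩
    have := e.injective (Subtype.ext h1)
    subst this
    exact h2
  · intro hi
    exact ⟨⟨T, hT⟩, rfl, hi⟩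

theorem dag_neg (φ : MForm ℕ) : (MForm.neg φ).dagSize ≤ φ.dagSize + 1 :=
  Finset.card_insert_le _ _

theorem dag_and (φ ψ : MForm ℕ) : (MForm.and φ ψ).dagSize ≤ φ.dagSize + ψ.dagSize + 1 :=
  (Finset.card_insert_le _ _).trans (Nat.succ_le_succ (Finset.card_union_le _ _))

theorem dag_atom (p : ℕ) : (MForm.atom p).dagSize = 1 := rfl

theorem mem_subf (φ : MForm ℕ) : φ ∈ φ.subf := by
  cases φ <;> simp [MForm.subf]

theorem dag_pos (φ : MForm ℕ) : 0 < φ.dagSize := Finset.card_pos.2 ⟨φ, mem_subf φ⟩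

theorem dag_andbox (φ : MForm ℕ) : (MForm.and φ (.box φ)).dagSize ≤ φ.dagSize + 2 := by
  unfold MForm.dagSize
  simp only [MForm.subf]
  refine (Finset.card_insert_le _ _).trans ?_
  rw [Finset.union_insert, Finset.union_self]
  have := Finset.card_insert_le (MForm.box φ) φ.subf
  omega

theorem dag_bb (k : ℕ) : ∀ φ, (bb k φ).dagSize ≤ φ.dagSize + 2 * k := by
  induction k with
  | zero => intro φ; simp [bb]
  | succ k ih =>
    intro φ
    have h1 := ih (.and φ (.box φ))
    have h2 := dag_andbox φ
    simp only [bb]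
    omega

theorem dag_orF (a b : MForm ℕ) : (orF a b).dagSize ≤ a.dagSize + b.dagSize + 4 := by
  have h1 := dag_neg a
  have h2 := dag_neg b
  have h3 := dag_and a.neg b.neg
  have h4 := dag_neg (a.neg.and b.neg)
  unfold orF
  omega

theorem dag_bigAnd (K : ℕ) (l : List (MForm ℕ)) (h : ∀ φ ∈ l, φ.dagSize ≤ K) :
    (bigAnd l).dagSize ≤ 1 + l.length * (K + 1) := by
  induction l with
  | nil => simp [bigAnd, MForm.dagSize, MForm.subf]
  | cons a l ih =>
    have h1 := ih (fun φ hφ => h φ (by simp [hφ]))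
    have h2 := h a (by simp)
    have h3 := dag_and a (bigAnd l)
    simp only [bigAnd, List.length_cons, Nat.succ_mul]
    omega

theorem dag_eqF (i : ℕ) : (eqF i).dagSize ≤ 12 := by
  have h1 := dag_and (.atom (2*i)) (.atom (2*i+1))
  have h2 := dag_and (.neg (.atom (2*i))) (.neg (.atom (2*i+1)))
  have h3 := dag_neg (.atom (2*i))
  have h4 := dag_neg (.atom (2*i+1))
  have h5 := dag_orF (.and (.atom (2*i)) (.atom (2*i+1)))
    (.and (.neg (.atom (2*i))) (.neg (.atom (2*i+1))))
  simp only [dag_atom] at h1 h3 h4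
  unfold eqF
  omega

theorem dag_constF (N i : ℕ) : (constF N i).dagSize ≤ 7 + 4 * N := by
  have h1 := dag_bb N (.atom (2*i+1))
  have h2 := dag_bb N (.neg (.atom (2*i+1)))
  have h4 := dag_neg (.atom (2*i+1))
  have h5 := dag_orF (bb N (.atom (2*i+1))) (bb N (.neg (.atom (2*i+1))))
  simp only [dag_atom] at h1 h4
  unfold constF
  omega

theorem dag_phiF (m N : ℕ) :
    (phiF m N).dagSize ≤ 4 + m * (8 + 4 * N) + m * 13 + 2 * N := by
  have h1 := dag_bigAnd (7 + 4 * N) ((List.range m).map (constF N)) (by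
    intro φ hφ
    obtain ⟨i, _, rfl⟩ := List.mem_map.1 hφ
    exact dag_constF N i)
  have h2 := dag_bigAnd 12 ((List.range m).map eqF) (by
    intro φ hφ
    obtain ⟨i, _, rfl⟩ := List.mem_map.1 hφ
    exact dag_eqF i)
  have h3 := dag_neg (bigAnd ((List.range m).map eqF))
  have h4 := dag_bb N (.neg (bigAnd ((List.range m).map eqF)))
  have h5 := dag_and (bigAnd ((List.range m).map (constF N)))
    (bb N (.neg (bigAnd ((List.range m).map eqF))))
  simp only [List.length_map, List.length_range] at h1 h2
  have e : 7 + 4 * N + 1 = 8 + 4 * N := by omega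
  rw [e] at h1
  unfold phiF
  omega

theorem eval_le (r : Polynomial ℕ) (s : ℕ) (hs : 0 < s) :
    r.eval s ≤ r.eval 1 * s ^ r.natDegree := by
  rw [Polynomial.eval_eq_sum_range, Polynomial.eval_eq_sum_range, Finset.sum_mul]
  refine Finset.sum_le_sum fun i hi => ?_
  rw [one_pow, mul_one]
  exact Nat.mul_le_mul_left _
    (Nat.pow_le_pow_right hs (Nat.lt_succ_iff.1 (Finset.mem_range.1 hi)))

/-- if the quasi-normal logic `L` is contained in a quasi-normal logic `L'`
with the poly-size model property and the exponential growth property, then there are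
polynomially sized formulas `φ_n` and signatures `σ_n ⊆ sig(φ_n)` such that, for all
sufficiently large `n`, the strongest `L(σ_n)`-implicate of `φ_n` exists and every
strongest `L(σ_n)`-implicate of `φ_n` has dag-size at least `2^n`. -/
theorem stmt15 (𝓕 𝓕' : Set PFrame) (L L' : Set (MForm ℕ))
    (hL : L = Log 𝓕) (hL' : L' = Log 𝓕') (hsub : L ⊆ L')
    (hpsmp : PSMP L') (hegp : EGP L') :
    ∃ (p : Polynomial ℕ) (φ : ℕ → MForm ℕ) (σ : ℕ → Finset ℕ),
      (∀ n, σ n ⊆ (φ n).sig) ∧ (∀ n, (φ n).dagSize ≤ p.eval n) ∧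
      ∃ n₀ : ℕ, ∀ n ≥ n₀,
        (∃ χ, StrImp L (σ n) (φ n) χ) ∧
        ∀ χ, StrImp L (σ n) (φ n) χ → 2 ^ n ≤ χ.dagSize := by

  obtain ⟨r, hr⟩ := hpsmp
  obtain ⟨f, hf⟩ := hegp
  subst hL
  set A := r.eval 1 with hA
  set d := r.natDegree with hd
  let mP : Polynomial ℕ := Polynomial.C (A + 1) + Polynomial.X * Polynomial.C d
  let NP : Polynomial ℕ := f.comp mP
  have hm : ∀ n, mP.eval n = A + 1 + n * d := by intro n; simp [mP]
  have hN : ∀ n, NP.eval n = f.eval (mP.eval n) := by intro n; simp [NP]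
  refine ⟨4 + mP * (8 + 4 * NP) + mP * 13 + 2 * NP, fun n => phiF (mP.eval n) (NP.eval n),
    fun n => sigF (mP.eval n), fun n => sig_phiF _ _, ?_, 0, ?_⟩
  · intro n
    refine (dag_phiF _ _).trans (le_of_eq ?_)
    simp
  · intro n _
    refine ⟨⟨_, chi_strImp 𝓕 _ _⟩, ?_⟩
    intro χ hχ
    obtain ⟨hs, hi, hu⟩ := hχ
    have hstr := chi_strImp 𝓕 (mP.eval n) (NP.eval n)
    have h1 := hsub (hu _ hstr.1 hstr.2.1)
    have h2 := hsub (hstr.2.2 χ hs hi)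
    have hχ' : χ ∉ L' := by
      intro hmem
      obtain ⟨F, w, _, hval, S, hS, hreach⟩ := hf (mP.eval n) (by rw [hm]; omega)
      rw [← hN] at hreach
      obtain ⟨V, hV⟩ := exists_not_QQ _ _ F w S hS hreach
      have a := hval _ h1 V
      rw [sat_imp, sat_chiF] at a
      exact hV (a (hval _ hmem V))
    obtain ⟨F, w, _, hval, hfin, hcard, V, hV⟩ := hr χ hχ'
    have hnQ : ¬ QQ (mP.eval n) (NP.eval n) F V w := by
      intro hQ
      have a := hval _ h2 V
      rw [sat_imp, sat_chiF] at a
      exact hV (a hQ)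
    have hc := card_of_not_QQ _ _ F V w hnQ
    by_contra hlt
    push Not at hlt
    have b1 := eval_le r χ.dagSize (dag_pos χ)
    have b2 : χ.dagSize ^ d ≤ 2 ^ (n * d) := by
      rw [pow_mul]; exact Nat.pow_le_pow_left hlt.le d
    have b3 : A * χ.dagSize ^ d ≤ A * 2 ^ (n * d) := Nat.mul_le_mul_left _ b2
    have b4 : A < 2 ^ (A + 1) := A.lt_two_pow_self.trans (Nat.pow_lt_pow_right (by omega) (by omega))
    have b5 : A * 2 ^ (n * d) < 2 ^ (A + 1) * 2 ^ (n * d) :=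
      Nat.mul_lt_mul_of_pos_right b4 (by positivity)
    rw [hm, pow_add] at hc
    exact absurd (hc.trans (hcard.trans (b1.trans b3))) (not_le.2 b5)
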